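/- Let (a_{−k−1})_{k≥0} be a sequence in ℚ((q)) satisfying the lower bound condition, with residue series r_j, and set f_k = Σ_{k'=0}^{k} binom[k'+k, 2k']·a_{−k'−1} ∈ ℚ((q)). Then for every integer k ≥ 0 the family ((q^{−j(k+1)} + q^{jk})·r_j)_{j≥1} is summable in ℚ((q)) and f_k = −r_0 − Σ_{j=1}^{∞} (q^{−j(k+1)} + q^{jk})·r_j. -/

import Mathlib

noncomputable section

/-- The Laurent series variable `q` of `ℚ((q))`. -/
def qq : LaurentSeries ℚ := HahnSeries.single 1 1

/-- `(q)_m = ∏_{i=1}^{m}(1−qⁱ)` in `ℚ((q))`. -/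
def qPoch (m : ℕ) : LaurentSeries ℚ := ∏ i ∈ Finset.range m, (1 - qq ^ (i + 1))

/-- `(q)_∞ = ∏_{i≥1}(1−qⁱ)` in `ℚ((q))` (a convergent infinite product for the
`q`-adic topology). -/
def qInf : LaurentSeries ℚ := ∏' i : ℕ, (1 - qq ^ (i + 1))

/-- `ρ_{k,j} = −(−1)^{k+j}·q^{k(k+1)/2+j(j+1)/2}·((q)_{k+j}(q)_{k−j})⁻¹` for
`k ≥ |j|` (and `0` for `k < |j|`). -/
def ρ (k : ℕ) (j : ℤ) : LaurentSeries ℚ :=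
  if (k : ℤ) < |j| then 0
  else -((-1 : LaurentSeries ℚ) ^ ((k : ℤ) + j) *
    qq ^ ((k : ℤ) * ((k : ℤ) + 1) / 2 + j * (j + 1) / 2) *
    (qPoch ((k : ℤ) + j).toNat * qPoch ((k : ℤ) - j).toNat)⁻¹)

/-- The lower bound condition: `δ(a_{−k−1}) ≥ −(k+1)(k−2)/2 + C` for all `k ≥ 0`
(stated coefficientwise, which also covers vanishing terms). -/
def LBC (a : ℕ → LaurentSeries ℚ) (C : ℤ) : Prop :=
  ∀ k : ℕ, ∀ w : ℤ, 2 * w < -(((k : ℤ) + 1) * ((k : ℤ) - 2)) + 2 * C → (a k).coeff w = 0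

/-- The residue series `r_j = Σ_{k≥|j|} a_{−k−1}·ρ_{k,j}`. -/
def resid (a : ℕ → LaurentSeries ℚ) (j : ℤ) : LaurentSeries ℚ := ∑' k : ℕ, a k * ρ k j

/-- The balanced Gaussian binomial `binom[k+i, 2k]`, as a Laurent polynomial in `q`:
`binom[k+i,2k] = q^{k(k−i)}·∏_{j=0}^{2k−1}(q^{k+i−j}−1) / ∏_{j=0}^{2k−1}(q^{2k−j}−1)`. -/
def bq (i k : ℕ) : LaurentSeries ℚ :=
  qq ^ ((k : ℤ) * ((k : ℤ) - (i : ℤ))) *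
    (∏ j ∈ Finset.range (2 * k), (qq ^ ((k : ℤ) + i - j) - 1)) *
    (∏ j ∈ Finset.range (2 * k), (qq ^ ((2 * k : ℤ) - j) - 1))⁻¹

/-!
STATEMENT 13: Let (a_{−k−1})_{k≥0} be a sequence in ℚ((q)) satisfying the lower
bound condition, with residue series r_j, and set
f_k = Σ_{k'=0}^{k} binom[k'+k, 2k']·a_{−k'−1}.  Then for every k ≥ 0 the family
((q^{−j(k+1)} + q^{jk})·r_j)_{j≥1} is summable in ℚ((q)) and
f_k = −r_0 − Σ_{j=1}^{∞} (q^{−j(k+1)} + q^{jk})·r_j.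
-/

theorem aux_nonarch : NonarchimedeanRing (LaurentSeries ℚ) := by
  have := Valued.toUniformSpace_eq (LaurentSeries ℚ) (WithZero (Multiplicative ℤ))
  have h2 := (Valued.v.subgroups_basis (R := LaurentSeries ℚ) (Γ₀ := WithZero (Multiplicative ℤ))).nonarchimedean
  convert h2

open WithZero in
theorem aux_summable {ι : Type} (F : ι → LaurentSeries ℚ)
    (h : ∀ D : ℤ, {i | ¬ Valued.v (F i) ≤ exp (-D)}.Finite) : Summable F := by
  have := aux_nonarch
  apply NonarchimedeanAddGroup.summable_of_tendsto_cofinite_zero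
  intro s hs
  obtain ⟨γ, hγ⟩ := Valued.mem_nhds_zero.1 hs
  have hD : exp (-(-(log (MonoidWithZeroHom.ValueGroup₀.embedding γ.1) - 1))) <
      MonoidWithZeroHom.ValueGroup₀.embedding γ.1 := by
    rw [← lt_log_iff_exp_lt (by simp)]
    simp
  refine Filter.mem_map.2 (Filter.mem_of_superset (h (-(log (MonoidWithZeroHom.ValueGroup₀.embedding γ.1) - 1))).compl_mem_cofinite ?_)
  intro i hi
  apply hγ
  simp only [Set.mem_compl_iff, Set.mem_ofPred_eq, not_not] at hi
  refine (Valued.v.restrict_lt_iff_lt_embedding (x := F i)).2 ?_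
  exact hi.trans_lt hD

theorem aux_vq (m : ℤ) : Valued.v (qq ^ m) = WithZero.exp (-m) := by
  rw [qq, ← RatFunc.single_zpow, LaurentSeries.valuation_single_zpow]

theorem aux_v1 (i : ℕ) : Valued.v (1 - qq ^ (i + 1)) = 1 := by
  apply Valuation.map_one_sub_of_lt
  have := aux_vq (i + 1 : ℕ)
  rw [zpow_natCast] at this
  rw [this, ← WithZero.exp_zero, WithZero.exp_lt_exp]
  push_cast; omega

theorem aux_vP (m : ℕ) : Valued.v (qPoch m) = 1 := by
  rw [qPoch, map_prod]
  exact Finset.prod_eq_one fun i _ => aux_v1 i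

theorem aux_P0 (m : ℕ) : qPoch m ≠ 0 := by
  intro h0
  have := aux_vP m
  rw [h0, map_zero] at this
  exact zero_ne_one this

theorem aux_q0 : qq ≠ 0 := by
  simp [qq]

theorem aux_Psucc (m : ℕ) : qPoch (m+1) = qPoch m * (1 - qq ^ (m+1)) := by
  rw [qPoch, Finset.prod_range_succ]; rfl

def auxG : ℕ → ℕ → LaurentSeries ℚ
  | _, 0 => 1
  | 0, _+1 => 0
  | N+1, m+1 => auxG N (m+1) + qq ^ (N - m) * auxG N m

theorem auxG_zero (N m : ℕ) (h : N < m) : auxG N m = 0 := by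
  induction N generalizing m with
  | zero => obtain ⟨m, rfl⟩ := Nat.exists_eq_succ_of_ne_zero (by omega : m ≠ 0); simp [auxG]
  | succ N ih =>
    obtain ⟨m, rfl⟩ := Nat.exists_eq_succ_of_ne_zero (by omega : m ≠ 0)
    rw [auxG, ih _ (by omega), ih _ (by omega)]; simp

theorem auxG_zr (N : ℕ) : auxG N 0 = 1 := by
  cases N <;> simp [auxG]

theorem auxG_eq (N m n : ℕ) (h : m + n = N) : auxG N m * (qPoch m * qPoch n) = qPoch N := by
  induction N generalizing m n with
  | zero =>
    obtain rfl : m = 0 := by omega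
    obtain rfl : n = 0 := by omega
    simp [auxG, qPoch]
  | succ N ih =>
    cases m with
    | zero =>
      obtain rfl : n = N + 1 := by omega
      simp [auxG_zr, qPoch]
    | succ m =>
      rw [auxG]
      have h1 := ih m n (by omega)
      have e : N - m = n := by omega
      rw [e]
      cases n with
      | zero =>
        obtain rfl : m = N := by omega
        rw [auxG_zero _ _ (by omega), aux_Psucc]
        linear_combination (1 - qq^(m+1)) * h1
      | succ n =>
        have h2 := ih (m+1) n (by omega)
        obtain rfl : N = m + 1 + n := by omega
        rw [aux_Psucc m, aux_Psucc n, aux_Psucc (m+1+n)] at *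
        linear_combination (1 - qq^(n+1)) * h2 + qq^(n+1) * (1 - qq^(m+1)) * h1

theorem auxG_binom (N : ℕ) (x : LaurentSeries ℚ) :
    ∑ m ∈ Finset.range (N+1), (-1)^m * qq ^ (m.choose 2) * x ^ m * auxG N m =
      ∏ i ∈ Finset.range N, (1 - x * qq ^ i) := by
  induction N with
  | zero => simp [auxG]
  | succ N ih =>
    rw [Finset.prod_range_succ, ← ih, Finset.sum_range_succ']
    have e : ∀ m ∈ Finset.range (N+1), (-1)^(m+1) * qq ^ ((m+1).choose 2) * x ^ (m+1) * auxG (N+1) (m+1)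
       = (-1)^(m+1) * qq ^ ((m+1).choose 2) * x ^ (m+1) * auxG N (m+1) -
        ((-1)^m * qq ^ (m.choose 2) * x ^ m * auxG N m) * (x * qq ^ N) := by
      intro m hm
      have hm : m ≤ N := by simpa [Nat.lt_succ_iff] using hm
      obtain ⟨d, rfl⟩ := Nat.exists_eq_add_of_le hm
      rw [auxG, Nat.choose_succ_succ' m 1, Nat.choose_one_right]
      simp only [Nat.add_sub_cancel_left]
      ring
    rw [Finset.sum_congr rfl e, Finset.sum_sub_distrib, ← Finset.sum_mul]
    have := Finset.sum_range_succ' (fun m => (-1)^m * qq ^ (m.choose 2) * x ^ m * auxG N m) (N+1)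
    rw [Finset.sum_range_succ, auxG_zero N (N+1) (by omega)] at this
    simp only [auxG_zr] at *
    linear_combination -this

theorem aux_T (k n m l : ℕ) (h : m + l = 2 * n) :
    -(qq ^ (((m:ℤ) - n) * k) * ρ n ((m:ℤ) - n)) =
      qq ^ ((n:ℤ) * (n - k)) * (qPoch (2*n))⁻¹ *
       ((-1)^m * qq ^ (m.choose 2) * (qq ^ ((k:ℤ) - n + 1)) ^ m * auxG (2*n) m) := by
  have hG : auxG (2*n) m = qPoch (2*n) * (qPoch m * qPoch l)⁻¹ := by
    rw [← auxG_eq _ m l h, mul_assoc, mul_inv_cancel₀ (mul_ne_zero (aux_P0 _) (aux_P0 _)), mul_one]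
  have hn : ¬ (n:ℤ) < |(m:ℤ) - n| := by
    rw [not_lt, abs_le]; omega
  have e1 : ((n:ℤ) + (m - n)).toNat = m := by omega
  have e2 : ((n:ℤ) - (m - n)).toNat = l := by omega
  have e3 : (-1 : LaurentSeries ℚ) ^ ((n:ℤ) + (m - n)) = (-1)^m := by
    rw [← zpow_natCast]; congr 1; omega
  rw [ρ, if_neg hn, e1, e2, e3, hG]
  have hexp : ((m:ℤ) - n) * k + ((n:ℤ) * (n+1) / 2 + ((m:ℤ)-n) * ((m:ℤ) - n + 1) / 2) =
     (n:ℤ) * (n - k) + (m.choose 2 : ℕ) + ((k:ℤ) - n + 1) * m := by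
    obtain ⟨u, hu⟩ := (Int.even_mul_succ_self (n:ℤ)).two_dvd
    obtain ⟨w, hw⟩ := (Int.even_mul_succ_self ((m:ℤ)-n)).two_dvd
    have hc : (m:ℤ) * (m - 1) = 2 * (m.choose 2 : ℕ) := by
      have := Nat.triangle_succ (m-1)
      cases m with
      | zero => simp
      | succ m =>
        have h3 := Nat.choose_two_right (m+1)
        have h4 : 2 ∣ (m+1) * m := by
          rw [mul_comm]; exact (Nat.even_mul_succ_self m).two_dvd
        have h5 : (m+1) * m = 2 * (m+1).choose 2 := by
          rw [h3]; simp only [Nat.add_sub_cancel]; omega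
        have h6 : (((m+1) * m : ℕ) : ℤ) = ((2 * (m+1).choose 2 : ℕ) : ℤ) := by rw [h5]
        push_cast at h6 ⊢
        linarith
    rw [hu, hw, Int.mul_ediv_cancel_left _ (by norm_num), Int.mul_ediv_cancel_left _ (by norm_num)]
    linarith
  have hz : qq ^ (((m:ℤ) - n) * k) * qq ^ ((n:ℤ) * (n+1) / 2 + ((m:ℤ)-n) * ((m:ℤ) - n + 1) / 2) =
      qq ^ ((n:ℤ) * (n - k)) * qq ^ (m.choose 2) * (qq ^ ((k:ℤ) - n + 1)) ^ m := by
    rw [← zpow_natCast qq (m.choose 2), ← zpow_natCast (qq ^ ((k:ℤ) - n + 1)) m, ← zpow_mul,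
      ← zpow_add₀ aux_q0, ← zpow_add₀ aux_q0, ← zpow_add₀ aux_q0, hexp]
  have hP := inv_mul_cancel₀ (aux_P0 (2*n))
  linear_combination ((-1)^m * (qPoch m * qPoch l)⁻¹) * hz - 
    (qq ^ ((n:ℤ) * (n - k)) * qq ^ (m.choose 2) * (qq ^ ((k:ℤ) - n + 1)) ^ m) * ((-1)^m * (qPoch m * qPoch l)⁻¹) * hP

theorem aux_bq (k n : ℕ) : bq k n =
    ∑ m ∈ Finset.range (2*n+1), -(qq ^ (((m:ℤ) - n) * k) * ρ n ((m:ℤ) - n)) := by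
  have : ∀ m ∈ Finset.range (2*n+1), -(qq ^ (((m:ℤ) - n) * k) * ρ n ((m:ℤ) - n)) = 
      qq ^ ((n:ℤ) * (n - k)) * (qPoch (2*n))⁻¹ *
       ((-1)^m * qq ^ (m.choose 2) * (qq ^ ((k:ℤ) - n + 1)) ^ m * auxG (2*n) m) := by
    intro m hm
    have hm : m < 2*n+1 := by simpa using hm
    exact aux_T k n m (2*n-m) (by omega)
  rw [Finset.sum_congr rfl this, ← Finset.mul_sum, auxG_binom, bq]
  have p1 : ∏ j ∈ Finset.range (2 * n), (qq ^ ((n : ℤ) + k - j) - 1) =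
      ∏ i ∈ Finset.range (2*n), (1 - qq ^ ((k:ℤ) - n + 1) * qq ^ i) := by
    rw [← Finset.prod_range_reflect]
    have : ∀ j ∈ Finset.range (2*n), (qq ^ ((n : ℤ) + k - (2*n-1-j : ℕ)) - 1) =
        (-1) * (1 - qq ^ ((k:ℤ) - n + 1) * qq ^ j) := by
      intro j hj
      have hj : j < 2*n := by simpa using hj
      rw [← zpow_natCast qq j, ← zpow_add₀ aux_q0,
        show (n : ℤ) + k - (2*n-1-j : ℕ) = (k:ℤ) - n + 1 + j by omega]
      ring
    rw [Finset.prod_congr rfl this, Finset.prod_mul_distrib]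
    simp
  have p2 : ∏ j ∈ Finset.range (2 * n), (qq ^ ((2 * n : ℤ) - j) - 1) = qPoch (2*n) := by
    rw [← Finset.prod_range_reflect]
    have : ∀ j ∈ Finset.range (2*n), (qq ^ ((2 * n : ℤ) - (2*n-1-j : ℕ)) - 1) =
        (-1) * (1 - qq ^ (j+1)) := by
      intro j hj
      have hj : j < 2*n := by simpa using hj
      rw [← zpow_natCast qq (j+1),
        show (2 * n : ℤ) - (2*n-1-j : ℕ) = (j+1 : ℕ) by omega]
      ring
    rw [Finset.prod_congr rfl this, Finset.prod_mul_distrib]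
    simp [qPoch]
  rw [p1, p2]
  ring

theorem aux_bq_zero (k n : ℕ) (h : k < n) : bq k n = 0 := by
  rw [bq]
  have : ∏ j ∈ Finset.range (2 * n), (qq ^ ((n : ℤ) + k - j) - 1) = 0 := by
    apply Finset.prod_eq_zero (i := n + k) (by simp; omega)
    simp
  rw [this]; simp

/-- the coefficient of `r_j` -/
def auxc (k : ℕ) : ℕ → LaurentSeries ℚ
  | 0 => 1
  | j+1 => qq ^ (-((j : ℤ) + 1) * ((k : ℤ) + 1)) + qq ^ (((j : ℤ) + 1) * (k : ℤ))

theorem aux_rho_neg (n : ℕ) (j : ℤ) : ρ n (-j) = qq ^ (-j) * ρ n j := by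
  rw [ρ, ρ, abs_neg]
  split_ifs with h0
  · simp
  have e1 : (n:ℤ) - -j = n + j := by ring
  have e2 : (n:ℤ) + -j = n - j := by ring
  have e3 : (-1 : LaurentSeries ℚ) ^ ((n:ℤ) - j) = (-1) ^ ((n:ℤ) + j) := by
    rw [show (n:ℤ) + j = n - j + 2 * j by ring, zpow_add₀ (by norm_num), zpow_mul]
    simp
  have e4 : (n:ℤ) * (n+1)/2 + -j * (-j + 1) / 2 = -j + ((n:ℤ) * (n+1)/2 + j * (j+1) / 2) := by
    have : -j * (-j+1) = j * (j+1) + (-j) * 2 := by ring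
    rw [this, Int.add_mul_ediv_right _ _ (by norm_num)]; ring
  rw [e1, e2, e3, e4, zpow_add₀ aux_q0]
  ring

theorem aux_bracket (k n : ℕ) : 
    ∑ j ∈ Finset.range (n+1), auxc k j * ρ n j = - bq k n := by
  rw [aux_bq, show 2*n+1 = n + 1 + n by ring, Finset.sum_range_succ',
    Finset.sum_range_add _ (n + 1) n, Finset.sum_range_succ _ n,
    ← Finset.sum_range_reflect (fun m : ℕ => -(qq ^ (((m:ℤ) - n) * k) * ρ n ((m:ℤ) - n))) n]
  simp only [Finset.sum_neg_distrib]
  have a1 : ∀ j ∈ Finset.range n, auxc k (j+1) * ρ n ((j+1 : ℕ) : ℤ) =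
     qq ^ ((((n-1-j : ℕ):ℤ) - n) * k) * ρ n (((n-1-j : ℕ):ℤ) - n) + 
     qq ^ ((((n+1+j : ℕ):ℤ) - n) * k) * ρ n (((n+1+j : ℕ):ℤ) - n) := by
    intro j hj
    have hj : j < n := by simpa using hj
    rw [show ((n-1-j : ℕ):ℤ) - n = -(j+1 : ℤ) by omega, 
      show ((n+1+j : ℕ):ℤ) - n = (j+1 : ℤ) by omega, aux_rho_neg, ← mul_assoc, ← zpow_add₀ aux_q0,
      auxc, ← add_mul]
    push_cast
    congr 3
    ring
  rw [Finset.sum_congr rfl a1, Finset.sum_add_distrib]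
  simp [auxc]
  ring

open WithZero

theorem aux_vrho (n : ℕ) (j : ℤ) : 
    Valued.v (ρ n j) ≤ exp (-((n : ℤ) * ((n : ℤ) + 1) / 2 + j * (j + 1) / 2)) := by
  rw [ρ]
  split_ifs with h
  · simp
  · rw [Valuation.map_neg, map_mul, map_mul, map_inv₀, map_mul, aux_vP, aux_vP, aux_vq, map_zpow₀,
      Valuation.map_neg, map_one]
    simp

theorem aux_va (a : ℕ → LaurentSeries ℚ) (C : ℤ) (h : LBC a C) (n : ℕ) :
    Valued.v (a n) ≤ exp (-(C + n + 1 - (n:ℤ) * (n+1) / 2)) := by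
  rw [LaurentSeries.valuation_le_iff_coeff_lt_eq_zero]
  intro w hw
  apply h n w
  obtain ⟨u, hu⟩ := (Int.even_mul_succ_self (n:ℤ)).two_dvd
  rw [hu, Int.mul_ediv_cancel_left _ (by norm_num)] at hw
  linarith

theorem aux_vc (k j : ℕ) : Valued.v (auxc k j) ≤ exp ((j:ℤ) * (k+1)) := by
  cases j with
  | zero => simp [auxc]
  | succ j => 
    rw [auxc]
    apply Valuation.map_add_le <;> rw [aux_vq, exp_le_exp]
    · push_cast; linarith
    · push_cast; nlinarith

theorem aux_main_summable (a : ℕ → LaurentSeries ℚ) (C : ℤ) (h : LBC a C) (k : ℕ) :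
    Summable (Function.uncurry fun (j n : ℕ) => auxc k j * (a n * ρ n j)) := by
  apply aux_summable
  intro D
  have hfin : (Set.Iio (D + |C| + (2*k+1)^2).toNat ×ˢ Set.Iio (D + |C| + (2*k+1)^2).toNat).Finite :=
    (Set.finite_Iio _).prod (Set.finite_Iio _)
  apply hfin.subset
  rintro ⟨j, n⟩ hx
  simp only [Set.mem_ofPred_eq, Function.uncurry_apply_pair] at hx
  have hjn : j ≤ n := by
    by_contra hlt
    apply hx
    rw [ρ, if_pos (by rw [abs_of_nonneg (by omega)]; omega)]
    simp
  have hb : (n:ℤ) < D + |C| + (2*k+1)^2 := by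
    by_contra hge
    apply hx
    rw [map_mul, map_mul]
    refine (mul_le_mul' (aux_vc k j) (mul_le_mul' (aux_va a C h n) (aux_vrho n j))).trans ?_
    rw [← exp_add, ← exp_add, exp_le_exp]
    obtain ⟨u, hu⟩ := (Int.even_mul_succ_self (j:ℤ)).two_dvd
    rw [hu, Int.mul_ediv_cancel_left _ (by norm_num)]
    have := neg_abs_le C
    nlinarith [sq_nonneg ((j:ℤ) - (2*k+1)), sq_nonneg ((j:ℤ))]
  simp only [Set.mem_prod, Set.mem_Iio]
  omega

theorem GM_coefficients_from_residues
    (a : ℕ → LaurentSeries ℚ) (C : ℤ) (h : LBC a C)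
    (f : ℕ → LaurentSeries ℚ)
    (hf : ∀ k : ℕ, f k = ∑ k' ∈ Finset.range (k + 1), bq k k' * a k') :
    ∀ k : ℕ,
      Summable (fun j : ℕ =>
        (qq ^ (-((j : ℤ) + 1) * ((k : ℤ) + 1)) + qq ^ (((j : ℤ) + 1) * (k : ℤ))) *
          resid a ((j : ℤ) + 1)) ∧
      f k = -(resid a 0) - ∑' j : ℕ,
        (qq ^ (-((j : ℤ) + 1) * ((k : ℤ) + 1)) + qq ^ (((j : ℤ) + 1) * (k : ℤ))) *
          resid a ((j : ℤ) + 1) := by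

  intro k
  have hs := aux_main_summable a C h k
  have e : ∀ j : ℕ, ∑' n, auxc k j * (a n * ρ n j) = auxc k j * resid a j := by
    intro j; rw [tsum_mul_left]; rfl
  have h1 : Summable (fun j : ℕ => auxc k j * resid a j) := by
    have := hs.prod
    simp only [Function.uncurry_apply_pair] at this
    simpa only [e] using this
  have h2 : Summable (fun j : ℕ => auxc k (j+1) * resid a ((j+1 : ℕ) : ℤ)) :=
    (summable_nat_add_iff 1).2 h1
  have h3 := hs.tsum_comm
  simp only [e] at h3
  rw [h1.tsum_eq_zero_add] at h3
  have h4 : ∀ n : ℕ, ∑' j : ℕ, auxc k j * (a n * ρ n j) = -(bq k n * a n) := by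
    intro n
    rw [tsum_eq_sum (s := Finset.range (n+1))]
    · rw [neg_mul_eq_neg_mul, ← aux_bracket, Finset.sum_mul]
      exact Finset.sum_congr rfl fun _ _ => by ring
    · intro j hj
      have hj : n < j := by simpa using hj
      rw [ρ, if_pos (by rw [abs_of_nonneg (by omega)]; omega)]
      simp
  simp only [h4] at h3
  rw [tsum_eq_sum (s := Finset.range (k+1)) (by
    intro n hn
    have hn : k < n := by simpa using hn
    rw [aux_bq_zero k n hn]; simp), Finset.sum_neg_distrib, ← hf k] at h3
  simp only [auxc, Nat.cast_add, Nat.cast_one, Nat.cast_zero, one_mul] at h2 h3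
  refine ⟨h2, ?_⟩
  linear_combination -h3
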